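/- In the partition algebra A_k(z): the element L_{i+1/2} commutes with p_i for every i with 1 ≤ i ≤ k−1, and L_{i+1/2} commutes with each of p_{i−1/2}, s_{i−1}, and p_{i−1} for every i with 2 ≤ i ≤ k−1. -/

import Mathlib

open Polynomial

/-- Elements of an algebra over `R = ℤ[z]` (with `z = Polynomial.X`) satisfying the
defining relations of the partition algebra `A_k(z)` of Halverson–Ram.
Here `p i` stands for the generator `p_i` (for `1 ≤ i ≤ k`), `q i` stands for the
half-integer generator `p_{i+1/2}` (for `1 ≤ i ≤ k-1`), and `s i` stands for `s_i`
(for `1 ≤ i ≤ k-1`). -/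
structure PartitionAlgebra (k : ℕ) (A : Type*) [Ring A] [Algebra (Polynomial ℤ) A] where
  p : ℕ → A
  q : ℕ → A
  s : ℕ → A
  s_sq : ∀ i, 1 ≤ i → i ≤ k - 1 → s i * s i = 1
  s_comm : ∀ i j, 1 ≤ i → i ≤ k - 1 → 1 ≤ j → j ≤ k - 1 → j ≠ i + 1 → i ≠ j + 1 →
    s i * s j = s j * s i
  braid : ∀ i, 1 ≤ i → i + 1 ≤ k - 1 →
    s i * s (i + 1) * s i = s (i + 1) * s i * s (i + 1)
  p_sq : ∀ i, 1 ≤ i → i ≤ k → p i * p i = (X : Polynomial ℤ) • p i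
  q_sq : ∀ i, 1 ≤ i → i ≤ k - 1 → q i * q i = q i
  s_q : ∀ i, 1 ≤ i → i ≤ k - 1 → s i * q i = q i
  q_s : ∀ i, 1 ≤ i → i ≤ k - 1 → q i * s i = q i
  s_pp : ∀ i, 1 ≤ i → i ≤ k - 1 → s i * (p i * p (i + 1)) = p i * p (i + 1)
  pp_s : ∀ i, 1 ≤ i → i ≤ k - 1 → p i * p (i + 1) * s i = p i * p (i + 1)
  p_comm : ∀ i j, 1 ≤ i → i ≤ k → 1 ≤ j → j ≤ k → p i * p j = p j * p i
  q_comm : ∀ i j, 1 ≤ i → i ≤ k - 1 → 1 ≤ j → j ≤ k - 1 → q i * q j = q j * q i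
  q_p : ∀ i j, 1 ≤ i → i ≤ k - 1 → 1 ≤ j → j ≤ k → j ≠ i → j ≠ i + 1 →
    q i * p j = p j * q i
  s_p : ∀ i j, 1 ≤ i → i ≤ k - 1 → 1 ≤ j → j ≤ k → j ≠ i → j ≠ i + 1 →
    s i * p j = p j * s i
  s_q' : ∀ i j, 1 ≤ i → i ≤ k - 1 → 1 ≤ j → j ≤ k - 1 → j + 1 ≠ i → j ≠ i + 1 →
    s i * q j = q j * s i
  sps : ∀ i, 1 ≤ i → i ≤ k - 1 → s i * p i * s i = p (i + 1)
  sqs : ∀ i, 2 ≤ i → i ≤ k - 1 →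
    s i * q (i - 1) * s i = s (i - 1) * q i * s (i - 1)
  qpq₁ : ∀ i, 1 ≤ i → i ≤ k - 1 → q i * p i * q i = q i
  qpq₂ : ∀ i, 1 ≤ i → i ≤ k - 1 → q i * p (i + 1) * q i = q i
  pqp₁ : ∀ i, 2 ≤ i → i ≤ k → p i * q (i - 1) * p i = p i
  pqp₂ : ∀ i, 1 ≤ i → i ≤ k - 1 → p i * q i * p i = p i

namespace PartitionAlgebra

variable {k : ℕ} {A : Type*} [Ring A] [Algebra (Polynomial ℤ) A]

/-- `(P.LS i).1 = L_i` and `(P.LS i).2 = σ_i` (with the junk value `σ_0 := 1`). -/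
def LS (P : PartitionAlgebra k A) : ℕ → A × A
  | 0 => (0, 1)
  | 1 => (P.p 1, 1)
  | n + 2 =>
    let Lp := (P.LS (n + 1)).1
    let sp := (P.LS (n + 1)).2
    let Lpp := (P.LS n).1
    let snew : A :=
      if n = 0 then P.s 1
      else
        P.s n * P.s (n + 1) * sp * P.s (n + 1) * P.s n
          + P.s (n + 1) * P.q n * Lpp * P.s (n + 1) * P.q n * P.s (n + 1)
          + P.q n * Lpp * P.s (n + 1) * P.q n
          - P.s (n + 1) * P.q n * Lpp * P.s n * P.q (n + 1) * P.p (n + 1) * P.q n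
          - P.q n * P.p (n + 1) * P.q (n + 1) * P.s n * Lpp * P.q n * P.s (n + 1)
    (-(P.s (n + 1) * Lp * P.q (n + 1)) - P.q (n + 1) * Lp * P.s (n + 1)
        + P.q (n + 1) * Lp * P.p (n + 2) * P.q (n + 1)
        + P.s (n + 1) * Lp * P.s (n + 1) + snew,
      snew)

/-- The Jucys–Murphy element `L_i` of the partition algebra. -/
def L (P : PartitionAlgebra k A) (i : ℕ) : A := (P.LS i).1

/-- The element `σ_i` of the partition algebra. -/
def sig (P : PartitionAlgebra k A) (i : ℕ) : A := (P.LS i).2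

/-- `(P.LSh i).1 = L_{i+1/2}` and `(P.LSh i).2 = σ_{i+1/2}`. -/
def LSh (P : PartitionAlgebra k A) : ℕ → A × A
  | 0 => (0, 1)
  | 1 =>
    (-(P.L 1 * P.q 1) - P.q 1 * P.L 1 + P.q 1 * P.L 1 * P.p 1 * P.q 1
        + P.s 1 * (0 : A) * P.s 1 + 1, 1)
  | n + 2 =>
    let Lhp := (P.LSh (n + 1)).1
    let shp := (P.LSh (n + 1)).2
    let snew : A :=
      P.s (n + 1) * P.s (n + 2) * shp * P.s (n + 2) * P.s (n + 1)
        + P.q (n + 1) * P.L (n + 1) * P.s (n + 2) * P.q (n + 1) * P.s (n + 2)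
        + P.s (n + 2) * P.q (n + 1) * P.L (n + 1) * P.s (n + 2) * P.q (n + 1)
        - P.q (n + 1) * P.L (n + 1) * P.s (n + 1) * P.q (n + 2) * P.p (n + 2) * P.q (n + 1)
        - P.s (n + 2) * P.q (n + 1) * P.p (n + 2) * P.q (n + 2) * P.s (n + 1)
            * P.L (n + 1) * P.q (n + 1) * P.s (n + 2)
    (-(P.L (n + 2) * P.q (n + 2)) - P.q (n + 2) * P.L (n + 2)
        + P.q (n + 2) * P.L (n + 2) * P.p (n + 2) * P.q (n + 2)
        + P.s (n + 2) * Lhp * P.s (n + 2) + snew,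
      snew)

/-- The half-integer Jucys–Murphy element `L_{i+1/2}` of the partition algebra. -/
def Lh (P : PartitionAlgebra k A) (i : ℕ) : A := (P.LSh i).1

/-- The element `σ_{i+1/2}` of the partition algebra. -/
def sigH (P : PartitionAlgebra k A) (i : ℕ) : A := (P.LSh i).2

end PartitionAlgebra

section Reassociation

variable {M : Type*} [Monoid M] {a b c d e f x y : M}

theorem eq_of_forall_mul_right_eq (h : ∀ z, x * z = y * z) : x = y := by
  simpa using h 1

theorem mul_tail₂ (h : a * b = x) (z : M) : a * (b * z) = x * z := by
  simp only [← h, mul_assoc]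

theorem mul_tail₃ (h : a * b * c = x) (z : M) : a * (b * (c * z)) = x * z := by
  simp only [← h, mul_assoc]

theorem mul_tail₄ (h : a * b * c * d = x) (z : M) :
    a * (b * (c * (d * z))) = x * z := by
  simp only [← h, mul_assoc]

theorem mul_tail₅ (h : a * b * c * d * e = x) (z : M) :
    a * (b * (c * (d * (e * z)))) = x * z := by
  simp only [← h, mul_assoc]

theorem mul_tail₆ (h : a * b * c * d * e * f = x) (z : M) :
    a * (b * (c * (d * (e * (f * z))))) = x * z := by
  simp only [← h, mul_assoc]

end Reassociation

/-- The relations among the generators of a partition algebra on three consecutive strands,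
with `a = p_i`, `b = p_{i+1}`, `u = p_{i+1/2}`, `v = p_{i+3/2}`, `s = s_i`, `t = s_{i+1}`. -/
structure ThreeStrands {M : Type*} [Monoid M] (a b u v s t : M) : Prop where
  ss : s * s = 1
  tt : t * t = 1
  tst : t * s * t = s * t * s
  su : s * u = u
  us : u * s = u
  tv : t * v = v
  vt : v * t = v
  uu : u * u = u
  vv : v * v = v
  vu : v * u = u * v
  sas : s * a * s = b
  ta : t * a = a * t
  va : v * a = a * v
  bub : b * u * b = b
  bvb : b * v * b = b
  aua : a * u * a = a
  uau : u * a * u = u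
  ubu : u * b * u = u
  vbv : v * b * v = v
  tut : t * u * t = s * v * s

namespace ThreeStrands

open MulOpposite

variable {M : Type*} [Monoid M] {a b u v s t : M}

theorem op (h : ThreeStrands a b u v s t) :
    ThreeStrands (op a) (op b) (op u) (op v) (op s) (op t) := by
  obtain ⟨ss, tt, tst, su, us, tv, vt, uu, vv, vu, sas, ta, va, bub, bvb, aua, uau, ubu, vbv,
    tut⟩ := h
  constructor <;> simp only [← op_mul, ← op_one, ← mul_assoc, *]

theorem as (h : ThreeStrands a b u v s t) : a * s = s * b := by
  simp only [← h.sas, ← mul_assoc, h.ss, one_mul]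

theorem sa (h : ThreeStrands a b u v s t) : s * a = b * s := by
  simp only [← h.sas, mul_assoc, h.ss, mul_one]

theorem sb (h : ThreeStrands a b u v s t) : s * b = a * s := h.as.symm

theorem sv (h : ThreeStrands a b u v s t) : s * v = t * u * t * s := by
  rw [h.tut, mul_assoc, h.ss, mul_one]

theorem vs (h : ThreeStrands a b u v s t) : v * s = s * t * u * t := by
  simp only [mul_assoc, h.tut, mul_tail₂ h.ss, one_mul]

theorem tuv (h : ThreeStrands a b u v s t) : t * u * v = u * v := by
  rw [mul_assoc, ← h.vu, ← mul_assoc, h.tv]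

theorem uvs (h : ThreeStrands a b u v s t) : u * v * s = u * v := by
  rw [← h.vu, mul_assoc, h.us]

theorem uts (h : ThreeStrands a b u v s t) : u * t * s = t * s * v := by
  simp only [mul_assoc, h.sv, mul_tail₂ h.tt, one_mul]

theorem vst (h : ThreeStrands a b u v s t) : v * s * t = s * t * u := by
  simp only [mul_assoc, h.vs, h.tt, mul_one]

theorem utu (h : ThreeStrands a b u v s t) : u * t * u = u * v := by
  calc u * t * u = t * (t * u * t) * u := by simp only [← mul_assoc, h.tt, one_mul]
    _ = t * (s * (v * u)) := by simp only [h.tut, mul_assoc, h.su]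
    _ = u * v := by rw [h.vu, ← mul_assoc s, h.su, ← mul_assoc, h.tuv]

theorem vsv (h : ThreeStrands a b u v s t) : v * s * v = u * v := by
  rw [h.vs, mul_assoc, h.tv, mul_assoc, mul_assoc, ← mul_assoc t, h.tuv, ← mul_assoc, h.su]

theorem vbuv (h : ThreeStrands a b u v s t) : v * b * u * v = u * v := by
  rw [mul_assoc, ← h.vu, ← mul_assoc, h.vbv]

theorem svsb (h : ThreeStrands a b u v s t) : s * v * s * b = b * s * v * s := by
  rw [mul_assoc, h.sb, ← mul_assoc, mul_assoc s v, h.va, ← mul_assoc, h.sa]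

theorem buvb (h : ThreeStrands a b u v s t) : b * u * v * b = s * v * s * b := by
  have huv : u * v = v * (s * v * s) := by simp only [← mul_assoc, h.vsv, h.uvs]
  rw [mul_assoc b, huv, ← mul_assoc, mul_assoc, h.svsb]
  simp only [← mul_assoc, h.bvb]

end ThreeStrands

/-- The relations between `Y = L_i`, `T = σ_{i+1/2}` and the generators of a partition algebra
on three consecutive strands. -/
structure Transfer {M : Type*} [Monoid M] (a b u v s t Y T : M) : Prop
    extends ThreeStrands a b u v s t where
  tY : t * Y = Y * t
  vY : v * Y = Y * v
  bY : b * Y = Y * b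
  sT : s * T = T * s
  vT : v * T = T * v
  Tu : T * u = u
  uT : u * T = u
  uYu : u * Y * u = u
  Yua : Y * u * a = T * a
  auY : a * u * Y = a * T

namespace Transfer

/-- The element `σ_{i+3/2}` in reduced form. -/
def sigma {A : Type*} [Ring A] (u s t Y T : A) : A :=
  s * t * T * t * s + u * Y * t * u * t + t * u * t * Y * u - t * T * t * u - T * t * u * t

/-- The element `L_{i+1}` expressed through `L_i` and `σ_{i+1/2}`. -/
def jm {A : Type*} [Ring A] (b u s Y T : A) : A :=
  -(s * Y * u) - u * Y * s + u * Y * b * u + s * Y * s + s * T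

section Monoid

variable {M : Type*} [Monoid M] {a b u v s t Y T : M}

open MulOpposite in
theorem op (h : Transfer a b u v s t Y T) :
    Transfer (op a) (op b) (op u) (op v) (op s) (op t) (op Y) (op T) := by
  obtain ⟨h', tY, vY, bY, sT, vT, Tu, uT, uYu, Yua, auY⟩ := h
  refine ⟨h'.op, ?_, ?_, ?_, ?_, ?_, ?_, ?_, ?_, ?_, ?_⟩ <;>
    simp only [← op_mul, ← mul_assoc, *]

theorem Yu (h : Transfer a b u v s t Y T) : Y * u = T * a * u := by
  rw [← h.Yua, mul_assoc, mul_assoc, ← mul_assoc u, h.uau]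

theorem sYu (h : Transfer a b u v s t Y T) : s * Y * u = T * b * u := by
  simp only [mul_assoc, h.Yu, mul_tail₂ h.sT, mul_tail₂ h.sa, h.su]

theorem Tsb (h : Transfer a b u v s t Y T) : T * s * b = Y * u * b := by
  rw [mul_assoc, h.sb, ← mul_assoc, ← h.Yua, mul_assoc, h.as, mul_assoc, ← mul_assoc u, h.us,
    mul_assoc]

theorem utTt (h : Transfer a b u v s t Y T) : u * t * T * t = t * T * t * u := by
  have hu : t * u = s * v * s * t := by rw [← h.tut, mul_assoc, h.tt, mul_one]
  have hu' : u * t = t * (s * v * s) := by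
    rw [← h.tut, ← mul_assoc, ← mul_assoc, h.tt, one_mul]
  rw [mul_assoc _ t u, hu, hu']
  simp only [mul_assoc, mul_tail₂ h.sT, mul_tail₂ h.vT]

theorem Ttut (h : Transfer a b u v s t Y T) : T * t * u * t = t * u * t * T := by
  rw [h.tut, mul_assoc, mul_assoc, ← mul_assoc t, h.tut]
  simp only [mul_assoc, h.sT, mul_tail₂ h.sT, mul_tail₂ h.vT]

theorem uYsvb (h : Transfer a b u v s t Y T) :
    u * Y * s * v * b = t * T * t * u * b := by
  calc u * Y * s * v * b = u * (Y * t) * (u * (t * (s * b))) := by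
        simp only [mul_assoc, mul_tail₂ h.sv]
    _ = u * t * (Y * u * a) * t * s := by
        simp only [← h.tY, h.sb, mul_assoc, mul_tail₂ h.ta]
    _ = u * t * T * t * (a * s) := by simp only [h.Yua, mul_assoc, mul_tail₂ h.ta]
    _ = t * T * t * u * b := by
        rw [h.utTt, h.as, mul_assoc _ u, ← mul_assoc u, h.us, ← mul_assoc]

theorem uYsvbu (h : Transfer a b u v s t Y T) :
    u * Y * s * v * b * u = t * T * t * u := by
  rw [h.uYsvb, mul_assoc _ b, mul_assoc _ u, ← mul_assoc u, h.ubu]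

theorem tTtsb (h : Transfer a b u v s t Y T) : t * T * t * s * b = Y * s * v * b := by
  calc t * T * t * s * b = t * (T * a) * t * s := by
        simp only [mul_assoc, h.sb, mul_tail₂ h.ta]
    _ = t * Y * u * (a * t) * s := by simp only [← h.Yua, mul_assoc]
    _ = Y * (t * u * t * s) * b := by simp only [h.tY, ← h.ta, mul_assoc, h.as]
    _ = Y * s * v * b := by rw [← h.sv, ← mul_assoc]

theorem tuYt (h : Transfer a b u v s t Y T) : t * u * Y * t = s * v * s * Y := by
  rw [mul_assoc _ Y, ← h.tY, ← mul_assoc, h.tut]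

theorem vsYsv (h : Transfer a b u v s t Y T) : v * s * Y * s * v = v := by
  refine eq_of_forall_mul_right_eq fun x ↦ ?_
  rw [mul_assoc _ s v, h.vs, h.sv]
  simp only [mul_assoc, mul_tail₂ h.tY, mul_tail₂ h.tt, one_mul, mul_tail₃ h.uYu,
    mul_tail₃ h.uts, mul_tail₂ h.ss]

theorem stTtu (h : Transfer a b u v s t Y T) : s * t * T * t * u = t * T * t * u := by
  calc s * t * T * t * u = s * (t * T * t * u) := by simp only [mul_assoc]
    _ = t * T * t * u := by rw [← h.utTt]; simp only [← mul_assoc, h.su]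

theorem Ttsv (h : Transfer a b u v s t Y T) : T * t * s * v = t * s * v := by
  simp only [mul_assoc, ← h.uts, mul_tail₂ h.Tu]

end Monoid

section Ring

variable {A : Type*} [Ring A] {a b u v s t Y T H Z : A}

theorem t_mul_sigma (h : Transfer a b u v s t Y T) :
    t * sigma u s t Y T = sigma u s t Y T * t := by
  refine eq_of_forall_mul_right_eq fun x ↦ ?_
  simp only [sigma, mul_add, mul_sub, add_mul, sub_mul, mul_assoc, mul_tail₂ h.tt, one_mul,
    mul_tail₃ h.tst, mul_tail₂ h.sT, mul_tail₂ h.tY]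
  abel

theorem sigma_mul_v (h : Transfer a b u v s t Y T) : sigma u s t Y T * v = v := by
  refine eq_of_forall_mul_right_eq fun x ↦ ?_
  simp only [sigma, add_mul, sub_mul, mul_assoc, mul_tail₂ h.tt, one_mul, mul_tail₂ h.tv,
    mul_tail₄ h.Ttsv, mul_tail₃ h.tuv, mul_tail₂ h.tY, mul_tail₃ h.uYu, mul_tail₂ h.Tu,
    mul_tail₂ h.ss]
  abel

theorem v_mul_jm_mul_v (h : Transfer a b u v s t Y T) : v * jm b u s Y T * v = v := by
  refine eq_of_forall_mul_right_eq fun x ↦ ?_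
  simp only [jm, mul_add, mul_sub, add_mul, sub_mul, mul_neg, neg_mul, mul_assoc,
    mul_tail₃ h.sYu, mul_tail₂ h.vT, mul_tail₄ h.vbuv, mul_tail₂ h.Tu, mul_tail₂ h.vu,
    mul_tail₂ h.vY, mul_tail₃ h.vsv, mul_tail₃ h.uYu, mul_tail₅ h.vsYsv, mul_tail₂ h.sT]
  abel

theorem jm_mul_v_mul_b (h : Transfer a b u v s t Y T) :
    jm b u s Y T * v * b = sigma u s t Y T * b := by
  refine eq_of_forall_mul_right_eq fun x ↦ ?_
  simp only [sigma, jm, add_mul, sub_mul, neg_mul, mul_assoc, mul_tail₃ h.tut,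
    mul_tail₃ h.sYu, mul_tail₂ h.vT, mul_tail₃ h.bub, mul_tail₄ h.buvb, mul_tail₂ h.sT,
    mul_tail₅ h.tTtsb, mul_tail₅ h.uYsvb]
  abel

open MulOpposite

theorem op_sigma (h : Transfer a b u v s t Y T) :
    MulOpposite.op (sigma u s t Y T) =
      sigma (MulOpposite.op u) (MulOpposite.op s) (MulOpposite.op t) (MulOpposite.op Y)
        (MulOpposite.op T) := by
  simp only [sigma, ← op_mul, ← op_add, ← op_sub, ← mul_assoc, ← h.utTt, h.Ttut]
  congr 1
  abel

theorem op_jm (h : Transfer a b u v s t Y T) :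
    MulOpposite.op (jm b u s Y T) =
      jm (MulOpposite.op b) (MulOpposite.op u) (MulOpposite.op s) (MulOpposite.op Y)
        (MulOpposite.op T) := by
  simp only [jm, ← op_mul, ← op_add, ← op_sub, ← op_neg, ← mul_assoc, ← h.sT]
  congr 1
  rw [mul_assoc u b, h.bY]
  simp only [← mul_assoc]
  abel

end Ring

end Transfer

/-- The relations of `Transfer` together with those satisfied by `H = L_{i-1/2}` and the central
element `Z = z`. -/
structure HalfTransfer {A : Type*} [Ring A] (a b u v s t Y T H Z : A) : Prop
    extends Transfer a b u v s t Y T where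
  tH : t * H = H * t
  vH : v * H = H * v
  uH : u * H = H * u
  Ya : Y * a = Z * a - H * a
  aY : a * Y = Z * a - a * H
  Z_comm : ∀ x, x * Z = Z * x

namespace HalfTransfer

open Transfer

/-- The element `L_{i+1/2}` expressed through `L_i`, `L_{i-1/2}` and `σ_{i+1/2}`. -/
def half {A : Type*} [Ring A] (a u s Y T H : A) : A :=
  -(Y * u) - u * Y + u * Y * a * u + s * H * s + T

variable {A : Type*} [Ring A] {a b u v s t Y T H Z : A}

open MulOpposite in
theorem op (h : HalfTransfer a b u v s t Y T H Z) :
    HalfTransfer (op a) (op b) (op u) (op v) (op s) (op t) (op Y) (op T) (op H) (op Z) where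
  toTransfer := h.toTransfer.op
  tH := by simp only [← op_mul, h.tH]
  vH := by simp only [← op_mul, h.vH]
  uH := by simp only [← op_mul, h.uH]
  Ya := by simp only [← op_mul, ← op_sub, h.aY, h.Z_comm]
  aY := by simp only [← op_mul, ← op_sub, h.Ya, h.Z_comm]
  Z_comm x := by rw [← op_unop x, ← op_mul, ← op_mul, h.Z_comm]

theorem uYau (h : HalfTransfer a b u v s t Y T H Z) : u * Y * a * u = Z * u - H * u := by
  rw [mul_assoc u, h.Ya, mul_sub, sub_mul, ← mul_assoc, ← mul_assoc, h.Z_comm, h.uH,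
    mul_assoc Z, mul_assoc Z, h.uau, mul_assoc H, mul_assoc H, h.uau]

theorem op_half (h : HalfTransfer a b u v s t Y T H Z) :
    MulOpposite.op (half a u s Y T H) =
      half (MulOpposite.op a) (MulOpposite.op u) (MulOpposite.op s) (MulOpposite.op Y)
        (MulOpposite.op T) (MulOpposite.op H) := by
  rw [half, half, h.uYau, h.op.uYau]
  simp only [← MulOpposite.op_mul, ← MulOpposite.op_add, ← MulOpposite.op_sub,
    ← MulOpposite.op_neg, ← mul_assoc, h.Z_comm, h.uH]
  congr 1
  abel

theorem sHsv (h : HalfTransfer a b u v s t Y T H Z) : s * H * s * v = v * s * H * s := by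
  rw [mul_assoc, h.sv, h.vs]
  simp only [mul_assoc, mul_tail₂ h.tH, mul_tail₂ h.uH]

theorem sHu (h : HalfTransfer a b u v s t Y T H Z) : s * H * u = H * u := by
  rw [mul_assoc, ← h.uH, ← mul_assoc, h.su]

theorem tsHsts (h : HalfTransfer a b u v s t Y T H Z) :
    t * s * H * s * t * s = s * t * s * H * s * t := by
  rw [mul_assoc _ s t, mul_assoc _ (s * t), ← h.tst]
  simp only [mul_assoc, mul_tail₂ h.tH]

theorem v_mul_half (h : HalfTransfer a b u v s t Y T H Z) :
    v * half a u s Y T H = half a u s Y T H * v := by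
  rw [half, h.uYau]
  refine eq_of_forall_mul_right_eq fun x ↦ ?_
  simp only [mul_add, mul_sub, add_mul, sub_mul, mul_neg, neg_mul, mul_assoc, mul_tail₂ h.vT,
    mul_tail₂ h.vY, mul_tail₂ h.vu, mul_tail₂ (h.Z_comm _), mul_tail₂ h.vH, mul_tail₄ h.sHsv]

theorem jm_mul_b (h : HalfTransfer a b u v s t Y T H Z) :
    jm b u s Y T * b = Z * b - half a u s Y T H * b := by
  have hYsb : Y * s * b = Z * s * b - H * s * b := by
    simp only [mul_assoc, h.sb]
    simp only [← mul_assoc, h.Ya, sub_mul]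
  rw [half, h.uYau]
  refine eq_of_forall_mul_right_eq fun x ↦ ?_
  simp only [jm, mul_sub, add_mul, sub_mul, neg_mul, mul_assoc,
    mul_tail₃ h.sYu, mul_tail₃ h.bub, mul_tail₃ hYsb, mul_tail₂ h.us, mul_tail₂ h.ss,
    mul_tail₂ (h.Z_comm _), mul_tail₂ h.uH, mul_tail₃ h.Tsb, mul_tail₂ h.sT, one_mul]
  abel

theorem v_mul_jm_mul_b_mul_v (h : HalfTransfer a b u v s t Y T H Z) :
    v * jm b u s Y T * b * v = Z * v - half a u s Y T H * v := by
  rw [mul_assoc v, h.jm_mul_b, mul_sub, sub_mul, ← mul_assoc, ← mul_assoc, h.Z_comm,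
    h.v_mul_half, mul_assoc Z, mul_assoc Z, h.vbv, mul_assoc _ v, mul_assoc _ (v * b), h.vbv]

theorem half_half_mul_u (h : HalfTransfer a b u v s t Y T H Z) :
    half b v t (jm b u s Y T) (sigma u s t Y T) (half a u s Y T H) * u =
      u * half b v t (jm b u s Y T) (sigma u s t Y T) (half a u s Y T H) := by
  rw [half, h.v_mul_jm_mul_b_mul_v, half, h.uYau]
  refine eq_of_forall_mul_right_eq fun x ↦ ?_
  simp only [jm, sigma, mul_add, mul_sub, add_mul, sub_mul, mul_neg, neg_mul, mul_assoc,
    mul_tail₂ (h.Z_comm _),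
    mul_tail₂ h.Tu, mul_tail₂ h.sT, mul_tail₂ h.su, mul_tail₂ h.tY, mul_tail₂ h.tH,
    mul_tail₂ h.uT, mul_tail₂ h.uH, mul_tail₂ h.us, mul_tail₂ h.uu, mul_tail₂ h.vY,
    mul_tail₂ h.vT, mul_tail₂ h.vH, mul_tail₂ h.vt, mul_tail₂ h.vu, mul_tail₃ h.sYu,
    mul_tail₃ h.sHu, mul_tail₃ h.ubu, mul_tail₄ h.tuYt,
    mul_tail₃ h.tut, mul_tail₃ h.uYu, mul_tail₃ h.uts, mul_tail₃ h.utu, mul_tail₃ h.uvs,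
    mul_tail₃ h.vst, mul_tail₄ h.utTt, mul_tail₅ h.stTtu]
  abel

theorem half_half_mul_s (h : HalfTransfer a b u v s t Y T H Z) :
    half b v t (jm b u s Y T) (sigma u s t Y T) (half a u s Y T H) * s =
      s * half b v t (jm b u s Y T) (sigma u s t Y T) (half a u s Y T H) := by
  rw [half, h.v_mul_jm_mul_b_mul_v, half, h.uYau]
  refine eq_of_forall_mul_right_eq fun x ↦ ?_
  simp only [jm, sigma, mul_add, mul_sub, add_mul, sub_mul, mul_neg, neg_mul, mul_assoc,
    mul_tail₂ (h.Z_comm _), one_mul,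
    mul_tail₂ h.ss, mul_tail₂ h.sT, mul_tail₂ h.su, mul_tail₂ h.tY, mul_tail₂ h.tH,
    mul_tail₂ h.us, mul_tail₂ h.vY, mul_tail₂ h.vT, mul_tail₂ h.vu, mul_tail₃ h.sYu,
    mul_tail₃ h.sHu, mul_tail₅ h.stTtu, mul_tail₆ h.tsHsts, mul_tail₃ h.Tsb, mul_tail₃ h.ubu,
    mul_tail₄ h.tuYt, mul_tail₃ h.tut, mul_tail₃ h.uvs]
  abel

end HalfTransfer

namespace Transfer

variable {A : Type*} [Ring A] {a b u v s t Y T : A}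

open MulOpposite

theorem v_mul_sigma (h : Transfer a b u v s t Y T) : v * sigma u s t Y T = v := by
  apply op_injective
  rw [op_mul, h.op_sigma]
  exact h.op.sigma_mul_v

theorem b_mul_v_mul_jm (h : Transfer a b u v s t Y T) :
    b * v * jm b u s Y T = b * sigma u s t Y T := by
  apply op_injective
  rw [op_mul, op_mul, op_mul, h.op_jm, h.op_sigma, ← mul_assoc]
  exact h.op.jm_mul_v_mul_b

theorem ubvsYu (h : Transfer a b u v s t Y T) : u * b * v * s * Y * u = u * t * T * t := by
  apply op_injective
  have := h.op.uYsvbu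
  simpa only [← op_mul, ← mul_assoc] using this

theorem sigma_eq (h : Transfer a b u v s t Y T) :
    s * t * T * t * s + u * Y * t * u * t + t * u * Y * t * u - u * Y * s * v * b * u -
      t * u * b * v * s * Y * u * t = sigma u s t Y T := by
  refine eq_of_forall_mul_right_eq fun x ↦ ?_
  simp only [sigma, add_mul, sub_mul, mul_assoc, mul_tail₆ h.uYsvbu, mul_tail₆ h.ubvsYu,
    mul_tail₂ h.tt, one_mul, mul_tail₂ h.tY, mul_tail₄ h.Ttut]

theorem commute_sigma {w r : A} (htwt : t * w * t = r * v * r) (h : Transfer a b u v s t Y T)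
    (ws : Commute w s) (wu : Commute w u) (wv : Commute w v) (wY : Commute w Y)
    (wT : Commute w T) (rT : Commute r T) : Commute w (sigma u s t Y T) := by
  have hconj : Commute w (t * T * t) := by
    have hT : Commute (t * w * t) T := htwt ▸ (rT.mul_left h.vT).mul_left rT
    calc w * (t * T * t) = t * ((t * w * t) * T) * t := by
          simp only [mul_assoc, mul_tail₂ h.tt, one_mul]
      _ = t * (T * (t * w * t)) * t := by rw [hT.eq]
      _ = t * T * t * w := by simp only [mul_assoc, h.tt, mul_one]
  have htut : Commute w (t * u * t) := h.tut ▸ (ws.mul_right wv).mul_right ws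
  have hsigma : sigma u s t Y T = s * (t * T * t) * s + u * Y * (t * u * t) +
      t * u * t * Y * u - t * T * t * u - T * (t * u * t) := by
    simp only [sigma, mul_assoc]
  rw [hsigma]
  exact (((((ws.mul_right hconj).mul_right ws).add_right
    ((wu.mul_right wY).mul_right htut)).add_right ((htut.mul_right wY).mul_right wu)).sub_right
    (hconj.mul_right wu)).sub_right
    (wT.mul_right htut)

end Transfer

namespace HalfTransfer

open Transfer

variable {A : Type*} [Ring A] {a b u v s t Y T H Z : A}

open MulOpposite in
theorem b_mul_jm (h : HalfTransfer a b u v s t Y T H Z) :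
    b * jm b u s Y T = Z * b - b * half a u s Y T H := by
  apply op_injective
  rw [op_mul, h.op_jm, op_sub, op_mul, op_mul, h.op_half]
  rw [h.op.jm_mul_b, h.op.Z_comm]

theorem half_half_mul_b {c : A} (htbt : t * b * t = c) (h : HalfTransfer a b u v s t Y T H Z)
    (hc : Commute c (half a u s Y T H)) :
    Commute (half b v t (jm b u s Y T) (sigma u s t Y T) (half a u s Y T H)) b := by
  have hconj : t * half a u s Y T H * t * b = b * t * half a u s Y T H * t := by
    subst htbt
    calc _ = t * (half a u s Y T H * (t * b * t)) * t := by
          simp only [mul_assoc, h.tt, mul_one]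
      _ = _ := by
          rw [← hc.eq]
          simp only [mul_assoc, mul_tail₂ h.tt, one_mul]
  have hleft : half b v t (jm b u s Y T) (sigma u s t Y T) (half a u s Y T H) * b =
      t * half a u s Y T H * t * b := by
    rw [half, h.v_mul_jm_mul_b_mul_v]
    simp only [add_mul, sub_mul, neg_mul, h.jm_mul_v_mul_b]
    rw [mul_assoc v, h.jm_mul_b, mul_sub, ← mul_assoc, ← mul_assoc, h.v_mul_half, h.Z_comm]
    abel
  have hright : b * half b v t (jm b u s Y T) (sigma u s t Y T) (half a u s Y T H) =
      b * t * half a u s Y T H * t := by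
    rw [half, h.v_mul_jm_mul_b_mul_v]
    simp only [mul_add, mul_sub, mul_neg, ← mul_assoc, h.b_mul_v_mul_jm]
    rw [h.b_mul_jm, sub_mul, h.Z_comm, mul_assoc b _ v]
    abel
  rw [Commute, SemiconjBy, hleft, hright, hconj]

end HalfTransfer

namespace PartitionAlgebra

open Transfer HalfTransfer

variable {k : ℕ} {A : Type*} [Ring A] [Algebra (Polynomial ℤ) A] (P : PartitionAlgebra k A)

theorem L_add_two (n : ℕ) : P.L (n + 2) =
    -(P.s (n + 1) * P.L (n + 1) * P.q (n + 1)) - P.q (n + 1) * P.L (n + 1) * P.s (n + 1)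
      + P.q (n + 1) * P.L (n + 1) * P.p (n + 2) * P.q (n + 1)
      + P.s (n + 1) * P.L (n + 1) * P.s (n + 1) + P.sig (n + 2) := rfl

theorem sig_add_three (n : ℕ) : P.sig (n + 3) =
    P.s (n + 1) * P.s (n + 2) * P.sig (n + 2) * P.s (n + 2) * P.s (n + 1)
      + P.s (n + 2) * P.q (n + 1) * P.L (n + 1) * P.s (n + 2) * P.q (n + 1) * P.s (n + 2)
      + P.q (n + 1) * P.L (n + 1) * P.s (n + 2) * P.q (n + 1)
      - P.s (n + 2) * P.q (n + 1) * P.L (n + 1) * P.s (n + 1) * P.q (n + 2) * P.p (n + 2)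
          * P.q (n + 1)
      - P.q (n + 1) * P.p (n + 2) * P.q (n + 2) * P.s (n + 1) * P.L (n + 1) * P.q (n + 1)
          * P.s (n + 2) := rfl

theorem Lh_succ (n : ℕ) : P.Lh (n + 1) =
    half (P.p (n + 1)) (P.q (n + 1)) (P.s (n + 1)) (P.L (n + 1)) (P.sigH (n + 1)) (P.Lh n) := by
  cases n <;> rfl

theorem sigH_add_two (n : ℕ) : P.sigH (n + 2) =
    P.s (n + 1) * P.s (n + 2) * P.sigH (n + 1) * P.s (n + 2) * P.s (n + 1)
      + P.q (n + 1) * P.L (n + 1) * P.s (n + 2) * P.q (n + 1) * P.s (n + 2)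
      + P.s (n + 2) * P.q (n + 1) * P.L (n + 1) * P.s (n + 2) * P.q (n + 1)
      - P.q (n + 1) * P.L (n + 1) * P.s (n + 1) * P.q (n + 2) * P.p (n + 2) * P.q (n + 1)
      - P.s (n + 2) * P.q (n + 1) * P.p (n + 2) * P.q (n + 2) * P.s (n + 1)
          * P.L (n + 1) * P.q (n + 1) * P.s (n + 2) := rfl

theorem commute_L_and_sig {x : A} (n : ℕ) (hp : ∀ j, 1 ≤ j → j ≤ n → Commute x (P.p j))
    (hq : ∀ j, 1 ≤ j → j + 1 ≤ n → Commute x (P.q j))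
    (hs : ∀ j, 1 ≤ j → j + 1 ≤ n → Commute x (P.s j)) :
    Commute x (P.L n) ∧ Commute x (P.sig n) := by
  induction n using Nat.strong_induction_on with
  | _ n ih =>
  have ih' : ∀ m < n, Commute x (P.L m) ∧ Commute x (P.sig m) := fun m hm ↦
    ih m hm (fun j h₁ h₂ ↦ hp j h₁ (by lia)) (fun j h₁ h₂ ↦ hq j h₁ (by lia))
      fun j h₁ h₂ ↦ hs j h₁ (by lia)
  match n with
  | 0 => exact ⟨Commute.zero_right x, Commute.one_right x⟩
  | 1 => exact ⟨hp 1 le_rfl le_rfl, Commute.one_right x⟩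
  | m + 2 =>
    have hY := (ih' (m + 1) (by lia)).1
    have ps := hs (m + 1) (by lia) (by lia)
    have pq := hq (m + 1) (by lia) (by lia)
    have pp := hp (m + 2) (by lia) (by lia)
    have hsig : Commute x (P.sig (m + 2)) := by
      cases m with
      | zero => exact hs 1 le_rfl le_rfl
      | succ m =>
        have hT := (ih' (m + 2) (by lia)).2
        have hY' := (ih' (m + 1) (by lia)).1
        have ps' := hs (m + 1) (by lia) (by lia)
        have pq' := hq (m + 1) (by lia) (by lia)
        have pp' := hp (m + 2) (by lia) (by lia)
        rw [sig_add_three]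
        repeat' first
          | assumption | apply Commute.add_right | apply Commute.sub_right | apply Commute.mul_right
    refine ⟨?_, hsig⟩
    rw [L_add_two]
    repeat' first
      | assumption | apply Commute.add_right | apply Commute.sub_right | apply Commute.mul_right
      | apply Commute.neg_right

theorem commute_sigH {x : A} (n : ℕ) (hp : ∀ j, 1 ≤ j → j ≤ n → Commute x (P.p j))
    (hq : ∀ j, 1 ≤ j → j ≤ n → Commute x (P.q j))
    (hs : ∀ j, 1 ≤ j → j ≤ n → Commute x (P.s j)) : Commute x (P.sigH n) := by
  induction n with
  | zero => exact Commute.one_right x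
  | succ n ih =>
  cases n with
  | zero => exact Commute.one_right x
  | succ m =>
    have hT := ih (fun j h₁ h₂ ↦ hp j h₁ (by lia)) (fun j h₁ h₂ ↦ hq j h₁ (by lia))
      fun j h₁ h₂ ↦ hs j h₁ (by lia)
    have hY := (P.commute_L_and_sig (x := x) (m + 1) (fun j h₁ h₂ ↦ hp j h₁ (by lia))
      (fun j h₁ h₂ ↦ hq j h₁ (by lia)) fun j h₁ h₂ ↦ hs j h₁ (by lia)).1
    have ps := hs (m + 1) (by lia) (by lia)
    have pq := hq (m + 1) (by lia) (by lia)
    have pp := hp (m + 2) (by lia) (by lia)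
    have ps' := hs (m + 2) (by lia) (by lia)
    have pq' := hq (m + 2) (by lia) (by lia)
    rw [sigH_add_two]
    repeat' first
      | assumption | apply Commute.add_right | apply Commute.sub_right | apply Commute.mul_right

theorem commute_Lh {x : A} (n : ℕ) (hp : ∀ j, 1 ≤ j → j ≤ n → Commute x (P.p j))
    (hq : ∀ j, 1 ≤ j → j ≤ n → Commute x (P.q j))
    (hs : ∀ j, 1 ≤ j → j ≤ n → Commute x (P.s j)) : Commute x (P.Lh n) := by
  induction n with
  | zero => exact Commute.zero_right x
  | succ n ih =>
    have hH := ih (fun j h₁ h₂ ↦ hp j h₁ (by lia)) (fun j h₁ h₂ ↦ hq j h₁ (by lia))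
      fun j h₁ h₂ ↦ hs j h₁ (by lia)
    have hT := P.commute_sigH (n + 1) hp hq hs
    have hY := (P.commute_L_and_sig (x := x) (n + 1) hp (fun j h₁ h₂ ↦ hq j h₁ (by lia))
      fun j h₁ h₂ ↦ hs j h₁ (by lia)).1
    have pp := hp (n + 1) (by lia) (by lia)
    have pq := hq (n + 1) (by lia) (by lia)
    have ps := hs (n + 1) (by lia) (by lia)
    rw [Lh_succ, half]
    repeat' first
      | assumption | apply Commute.add_right | apply Commute.sub_right | apply Commute.mul_right
      | apply Commute.neg_right

theorem commute_s_L {n j : ℕ} (hn : n + 1 ≤ j) (hj : j ≤ k - 1) : Commute (P.s j) (P.L n) :=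
  (P.commute_L_and_sig n (fun l _ _ ↦ P.s_p j l (by lia) hj (by lia) (by lia) (by lia) (by lia))
    (fun l _ _ ↦ P.s_q' j l (by lia) hj (by lia) (by lia) (by lia) (by lia))
    fun l _ _ ↦ P.s_comm j l (by lia) hj (by lia) (by lia) (by lia) (by lia)).1

theorem commute_q_L {n j : ℕ} (hn : n + 1 ≤ j) (hj : j ≤ k - 1) : Commute (P.q j) (P.L n) :=
  (P.commute_L_and_sig n (fun l _ _ ↦ P.q_p j l (by lia) hj (by lia) (by lia) (by lia) (by lia))
    (fun l _ _ ↦ P.q_comm j l (by lia) hj (by lia) (by lia))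
    fun l _ _ ↦ (P.s_q' l j (by lia) (by lia) (by lia) hj (by lia) (by lia)).symm).1

theorem commute_p_L {n j : ℕ} (hn : n + 1 ≤ j) (hj : j ≤ k) : Commute (P.p j) (P.L n) :=
  (P.commute_L_and_sig n (fun l _ _ ↦ P.p_comm j l (by lia) hj (by lia) (by lia))
    (fun l _ _ ↦ (P.q_p l j (by lia) (by lia) (by lia) hj (by lia) (by lia)).symm)
    fun l _ _ ↦ (P.s_p l j (by lia) (by lia) (by lia) hj (by lia) (by lia)).symm).1

theorem commute_s_sigH {n j : ℕ} (hn : n + 2 ≤ j) (hj : j ≤ k - 1) :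
    Commute (P.s j) (P.sigH n) :=
  P.commute_sigH n (fun l _ _ ↦ P.s_p j l (by lia) hj (by lia) (by lia) (by lia) (by lia))
    (fun l _ _ ↦ P.s_q' j l (by lia) hj (by lia) (by lia) (by lia) (by lia))
    fun l _ _ ↦ P.s_comm j l (by lia) hj (by lia) (by lia) (by lia) (by lia)

theorem commute_q_sigH {n j : ℕ} (hn : n + 2 ≤ j) (hj : j ≤ k - 1) :
    Commute (P.q j) (P.sigH n) :=
  P.commute_sigH n (fun l _ _ ↦ P.q_p j l (by lia) hj (by lia) (by lia) (by lia) (by lia))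
    (fun l _ _ ↦ P.q_comm j l (by lia) hj (by lia) (by lia))
    fun l _ _ ↦ (P.s_q' l j (by lia) (by lia) (by lia) hj (by lia) (by lia)).symm

theorem commute_s_Lh {n j : ℕ} (hn : n + 2 ≤ j) (hj : j ≤ k - 1) : Commute (P.s j) (P.Lh n) :=
  P.commute_Lh n (fun l _ _ ↦ P.s_p j l (by lia) hj (by lia) (by lia) (by lia) (by lia))
    (fun l _ _ ↦ P.s_q' j l (by lia) hj (by lia) (by lia) (by lia) (by lia))
    fun l _ _ ↦ P.s_comm j l (by lia) hj (by lia) (by lia) (by lia) (by lia)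

theorem commute_q_Lh {n j : ℕ} (hn : n + 2 ≤ j) (hj : j ≤ k - 1) : Commute (P.q j) (P.Lh n) :=
  P.commute_Lh n (fun l _ _ ↦ P.q_p j l (by lia) hj (by lia) (by lia) (by lia) (by lia))
    (fun l _ _ ↦ P.q_comm j l (by lia) hj (by lia) (by lia))
    fun l _ _ ↦ (P.s_q' l j (by lia) (by lia) (by lia) hj (by lia) (by lia)).symm

theorem commute_p_Lh {n j : ℕ} (hn : n + 2 ≤ j) (hj : j ≤ k) : Commute (P.p j) (P.Lh n) :=
  P.commute_Lh n (fun l _ _ ↦ P.p_comm j l (by lia) hj (by lia) (by lia))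
    (fun l _ _ ↦ (P.q_p l j (by lia) (by lia) (by lia) hj (by lia) (by lia)).symm)
    fun l _ _ ↦ (P.s_p l j (by lia) (by lia) (by lia) hj (by lia) (by lia)).symm

theorem s_mul_q_mul_s {n : ℕ} (hn : n + 2 ≤ k - 1) :
    P.s (n + 2) * P.q (n + 1) * P.s (n + 2) = P.s (n + 1) * P.q (n + 2) * P.s (n + 1) :=
  P.sqs (n + 2) (by lia) hn

theorem threeStrands {n : ℕ} (hn : n + 2 ≤ k - 1) :
    ThreeStrands (P.p (n + 1)) (P.p (n + 2)) (P.q (n + 1)) (P.q (n + 2)) (P.s (n + 1))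
      (P.s (n + 2)) where
  ss := P.s_sq _ (by lia) (by lia)
  tt := P.s_sq _ (by lia) (by lia)
  tst := (P.braid (n + 1) (by lia) (by lia)).symm
  su := P.s_q _ (by lia) (by lia)
  us := P.q_s _ (by lia) (by lia)
  tv := P.s_q _ (by lia) (by lia)
  vt := P.q_s _ (by lia) (by lia)
  uu := P.q_sq _ (by lia) (by lia)
  vv := P.q_sq _ (by lia) (by lia)
  vu := P.q_comm _ _ (by lia) (by lia) (by lia) (by lia)
  sas := P.sps _ (by lia) (by lia)
  ta := P.s_p _ _ (by lia) (by lia) (by lia) (by lia) (by lia) (by lia)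
  va := P.q_p _ _ (by lia) (by lia) (by lia) (by lia) (by lia) (by lia)
  bub := P.pqp₁ (n + 2) (by lia) (by lia)
  bvb := P.pqp₂ (n + 2) (by lia) (by lia)
  aua := P.pqp₂ (n + 1) (by lia) (by lia)
  uau := P.qpq₁ (n + 1) (by lia) (by lia)
  ubu := P.qpq₂ (n + 1) (by lia) (by lia)
  vbv := P.qpq₁ (n + 2) (by lia) (by lia)
  tut := P.s_mul_q_mul_s hn

theorem halfTransfer_and_sig {n : ℕ} (hn : n + 2 ≤ k - 1) :
    HalfTransfer (P.p (n + 1)) (P.p (n + 2)) (P.q (n + 1)) (P.q (n + 2)) (P.s (n + 1))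
      (P.s (n + 2)) (P.L (n + 1)) (P.sigH (n + 1)) (P.Lh n) (algebraMap (Polynomial ℤ) A X) ∧
    P.sig (n + 2) = P.s (n + 1) * P.sigH (n + 1) := by
  induction n with
  | zero =>
    have hL : P.L 1 = P.p 1 := rfl
    have hT : P.sigH 1 = 1 := rfl
    have hH : P.Lh 0 = 0 := rfl
    have hp : P.p 1 * P.p 1 = algebraMap (Polynomial ℤ) A X * P.p 1 := by
      rw [P.p_sq 1 le_rfl (by lia), Algebra.smul_def]
    have h := P.threeStrands hn
    refine ⟨?_, (mul_one _).symm⟩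
    simp only [zero_add, hL, hT, hH]
    exact {
      toThreeStrands := h
      tY := h.ta
      vY := h.va
      bY := P.p_comm _ _ (by lia) (by lia) (by lia) (by lia)
      sT := Commute.one_right _
      vT := Commute.one_right _
      Tu := one_mul _
      uT := mul_one _
      uYu := h.uau
      Yua := h.aua.trans (one_mul _).symm
      auY := h.aua.trans (mul_one _).symm
      tH := Commute.zero_right _
      vH := Commute.zero_right _
      uH := Commute.zero_right _
      Ya := by rw [hp, zero_mul, sub_zero]
      aY := by rw [hp, mul_zero, sub_zero]
      Z_comm := fun x ↦ (Algebra.commutes _ x).symm }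
  | succ n ih =>
    obtain ⟨h, hsig⟩ := ih (by lia)
    have hL : P.L (n + 2) = jm (P.p (n + 2)) (P.q (n + 1)) (P.s (n + 1)) (P.L (n + 1))
        (P.sigH (n + 1)) := by rw [L_add_two, hsig, jm]
    have hT : P.sigH (n + 2) = sigma (P.q (n + 1)) (P.s (n + 1)) (P.s (n + 2)) (P.L (n + 1))
        (P.sigH (n + 1)) := by rw [sigH_add_two, h.sigma_eq]
    have hH := P.Lh_succ n
    constructor
    · exact {
        toThreeStrands := P.threeStrands hn
        tY := P.commute_s_L (by lia) hn
        vY := P.commute_q_L (by lia) hn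
        bY := P.commute_p_L (by lia) (by lia)
        sT := by rw [hT]; exact h.t_mul_sigma
        vT := by
          rw [hT]
          exact h.commute_sigma (P.s_mul_q_mul_s hn).symm
            (P.s_q' _ _ (by lia) (by lia) (by lia) (by lia) (by lia) (by lia)).symm
            (P.q_comm _ _ (by lia) (by lia) (by lia) (by lia))
            (P.q_comm _ _ (by lia) (by lia) (by lia) (by lia)) (P.commute_q_L (by lia) hn)
            (P.commute_q_sigH (by lia) hn) (P.commute_s_sigH (by lia) hn)
        Tu := by rw [hT]; exact h.sigma_mul_v
        uT := by rw [hT]; exact h.v_mul_sigma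
        uYu := by rw [hL]; exact h.v_mul_jm_mul_v
        Yua := by rw [hL, hT]; exact h.jm_mul_v_mul_b
        auY := by rw [hL, hT]; exact h.b_mul_v_mul_jm
        tH := P.commute_s_Lh (by lia) hn
        vH := P.commute_q_Lh (by lia) hn
        uH := by rw [hH]; exact h.v_mul_half
        Ya := by rw [hL, hH]; exact h.jm_mul_b
        aY := by rw [hL, hH]; exact h.b_mul_jm
        Z_comm := fun x ↦ (Algebra.commutes _ x).symm }
    · rw [sig_add_three, sigH_add_two, hsig]
      have htt := mul_tail₂ h.tt
      have htst := mul_tail₃ h.tst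
      simp only [mul_add, mul_sub, mul_assoc, htt, htst, one_mul]

theorem Lh_add_two_comm {n : ℕ} (hn : n + 2 ≤ k - 1) :
    Commute (P.Lh (n + 2)) (P.p (n + 2)) ∧ Commute (P.Lh (n + 2)) (P.q (n + 1)) ∧
      Commute (P.Lh (n + 2)) (P.s (n + 1)) := by
  obtain ⟨h, hsig⟩ := P.halfTransfer_and_sig hn
  have hL : P.L (n + 2) = jm (P.p (n + 2)) (P.q (n + 1)) (P.s (n + 1)) (P.L (n + 1))
      (P.sigH (n + 1)) := by rw [L_add_two, hsig, jm]
  have hT : P.sigH (n + 2) = sigma (P.q (n + 1)) (P.s (n + 1)) (P.s (n + 2)) (P.L (n + 1))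
      (P.sigH (n + 1)) := by rw [sigH_add_two, h.sigma_eq]
  have hc : Commute (P.p (n + 3)) (P.Lh (n + 1)) := P.commute_p_Lh (by lia) (by lia)
  rw [P.Lh_succ n] at hc
  rw [P.Lh_succ (n + 1), hL, hT, P.Lh_succ n]
  exact ⟨h.half_half_mul_b (P.sps _ (by lia) (by lia)) hc, h.half_half_mul_u, h.half_half_mul_s⟩

end PartitionAlgebra

/-- Theorem 3.7(6)–(9): `L_{i+1/2}` commutes with `p_i` for `1 ≤ i ≤ k-1`, and with
`p_{i-1/2}`, `s_{i-1}`, `p_{i-1}` for `2 ≤ i ≤ k-1`. -/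
theorem partitionAlgebra_Lh_comm {k : ℕ} {A : Type*} [Ring A]
    [Algebra (Polynomial ℤ) A] (P : PartitionAlgebra k A) :
    (∀ i, 1 ≤ i → i ≤ k - 1 → P.Lh i * P.p i = P.p i * P.Lh i) ∧
    (∀ i, 2 ≤ i → i ≤ k - 1 →
      P.Lh i * P.q (i - 1) = P.q (i - 1) * P.Lh i ∧
      P.Lh i * P.s (i - 1) = P.s (i - 1) * P.Lh i ∧
      P.Lh i * P.p (i - 1) = P.p (i - 1) * P.Lh i) := by
  refine ⟨fun i h₁ hi ↦ ?_, fun i h₂ hi ↦ ?_⟩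
  · obtain rfl | ⟨n, rfl⟩ : i = 1 ∨ ∃ n, i = n + 2 := by
      rcases i with _ | _ | n
      · lia
      · exact .inl rfl
      · exact .inr ⟨n, rfl⟩
    · have hpqp := P.pqp₂ 1 le_rfl hi
      have hL : P.L 1 = P.p 1 := rfl
      have hT : P.sigH 1 = 1 := rfl
      have hH : P.Lh 0 = 0 := rfl
      rw [P.Lh_succ 0]
      simp only [HalfTransfer.half, zero_add, hL, hT, hH, mul_add, mul_sub, add_mul, sub_mul,
        mul_neg, neg_mul, mul_zero, zero_mul, mul_one, one_mul]
      simp only [mul_assoc, mul_tail₃ hpqp, (mul_assoc _ _ _).symm.trans hpqp]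
      abel
    · exact (P.Lh_add_two_comm hi).1
  · obtain ⟨n, rfl⟩ := Nat.exists_eq_add_of_le' h₂
    obtain ⟨hp, hq, hs⟩ := P.Lh_add_two_comm hi
    refine ⟨hq, hs, ?_⟩
    have hsps : P.s (n + 1) * P.p (n + 2) * P.s (n + 1) = P.p (n + 1) := by
      rw [← P.sps (n + 1) (by lia) (by lia)]
      have hss := P.s_sq (n + 1) (by lia) (by lia)
      simp only [mul_assoc, hss, mul_one]
      rw [← mul_assoc, hss, one_mul]
    rw [show n + 2 - 1 = n + 1 from rfl, ← hsps]
    exact ((hs.mul_right hp).mul_right hs).eq
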